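/- Let N ≥ 2 and ρ₁, …, ρ_N > 0. Let v₁, …, v_N : [0,∞) → ℝ be continuous on [0,∞) and twice continuously differentiable with v_j''(x) + f(v_j(x)) = 0 and 0 < v_j(x) ≤ 1 for all x ≥ 0 and all j, satisfying v₁(0) = ⋯ = v_N(0) and Σ_{j=1}^N ρ_j v_j'(0) = 0 (Kirchhoff condition at the junction). If v_j(x) → 1 as x → ∞ for every j = 1, …, N, then v_j(x) = 1 for all x ≥ 0 and all j. -/

import Mathlib

open Set Filter Topology

/-- The primitive `F(s) = ∫₀^s f(r) dr`. -/
noncomputable def F (f : ℝ → ℝ) (s : ℝ) : ℝ := ∫ r in (0:ℝ)..s, f r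

/-- Bistable nonlinearity with balanced-positive integral. -/
def Bistable (f : ℝ → ℝ) (a : ℝ) : Prop :=
  ContDiff ℝ 1 f ∧ 0 < a ∧ a < 1 ∧
  f 0 = 0 ∧ f a = 0 ∧ f 1 = 0 ∧
  (∀ s, 0 < s → s < a → f s < 0) ∧
  (∀ s, a < s → s < 1 → 0 < f s) ∧
  deriv f 0 < 0 ∧ 0 < deriv f a ∧ deriv f 1 < 0 ∧
  0 < ∫ s in (0:ℝ)..(1:ℝ), f s


lemma hasDerivAt_F {f : ℝ → ℝ} (hf : Continuous f) (s : ℝ) : HasDerivAt (F f) (f s) s :=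
  intervalIntegral.integral_hasDerivAt_right (hf.intervalIntegrable _ _)
    (hf.stronglyMeasurableAtFilter _ _) hf.continuousAt

lemma Bistable.continuous {f : ℝ → ℝ} {a : ℝ} (hf : Bistable f a) : Continuous f :=
  hf.1.continuous

lemma Bistable.F_lt_F_one {f : ℝ → ℝ} {a : ℝ} (hf : Bistable f a) {s : ℝ} (hs0 : 0 < s)
    (hs1 : s < 1) : F f s < F f 1 := by
  have hint : ∀ b c : ℝ, IntervalIntegrable f MeasureTheory.volume b c :=
    fun b c => hf.continuous.intervalIntegrable b c
  obtain ⟨-, -, -, -, hfa, -, hneg, hpos, -, -, -, hI⟩ := hf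
  rcases le_or_gt a s with has | has
  · have h : 0 < ∫ r in s..1, f r :=
      intervalIntegral.intervalIntegral_pos_of_pos_on (hint _ _)
        (fun x hx => hpos x (has.trans_lt hx.1) hx.2) hs1
    have hadd := intervalIntegral.integral_add_adjacent_intervals (hint 0 s) (hint s 1)
    unfold F
    linarith
  · have h : 0 < ∫ r in (0:ℝ)..s, -f r :=
      intervalIntegral.intervalIntegral_pos_of_pos_on (hint _ _).neg
        (fun x hx => neg_pos.2 (hneg x hx.1 (hx.2.trans has))) hs0
    rw [intervalIntegral.integral_neg] at h
    unfold F
    linarith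

/-- Energy identity for a solution of `v'' + f(v) = 0` on the half-line converging to `l`. -/
lemma energy_eq_of_tendsto {f v w : ℝ → ℝ} {l : ℝ} (hf : Continuous f)
    (hv : ∀ x, 0 ≤ x → HasDerivWithinAt v (w x) (Ici 0) x)
    (hw : ∀ x, 0 ≤ x → HasDerivWithinAt w (-f (v x)) (Ici 0) x)
    (hlim : Tendsto v atTop (𝓝 l)) {x : ℝ} (hx : 0 ≤ x) :
    w x ^ 2 / 2 + F f (v x) = F f l := by
  have hE : ∀ y, 0 ≤ y →
      HasDerivWithinAt (fun y => w y ^ 2 / 2 + F f (v y)) 0 (Ici 0) y := by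
    intro y hy
    have h := (((hw y hy).pow 2).div_const 2).add
      ((hasDerivAt_F hf (v y)).comp_hasDerivWithinAt y (hv y hy))
    refine h.congr_deriv ?_
    push_cast
    ring
  have hconst : ∀ y, 0 ≤ y → w y ^ 2 / 2 + F f (v y) = w 0 ^ 2 / 2 + F f (v 0) := by
    intro y hy
    refine constant_of_has_deriv_right_zero (f := fun y => w y ^ 2 / 2 + F f (v y))
      (fun z hz => ((hE z hz.1).continuousWithinAt).mono Icc_subset_Ici_self)
      (fun z hz => (hE z hz.1).mono (Ici_subset_Ici.2 hz.1)) y ⟨hy, le_rfl⟩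
  have hmvt : ∀ n : ℕ, ∃ c ∈ Ioo (n : ℝ) (n + 1), w c = v (n + 1) - v n := by
    intro n
    have hn : (0 : ℝ) ≤ n := n.cast_nonneg
    obtain ⟨c, hc, h⟩ := exists_hasDerivAt_eq_slope v w (lt_add_one (n : ℝ))
      (fun z hz => ((hv z (hn.trans hz.1)).continuousWithinAt).mono
        (fun t ht => hn.trans ht.1))
      (fun z hz => (hv z (hn.trans hz.1.le)).hasDerivAt (Ici_mem_nhds (hn.trans_lt hz.1)))
    exact ⟨c, hc, by simpa using h⟩
  choose c hc hwc using hmvt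
  have hctop : Tendsto c atTop atTop :=
    tendsto_atTop_mono (fun n => (hc n).1.le) tendsto_natCast_atTop_atTop
  have hw0 : Tendsto (fun n => w (c n)) atTop (𝓝 0) := by
    simp_rw [hwc]
    have h1 : Tendsto (fun n : ℕ => v ((n : ℝ) + 1)) atTop (𝓝 l) :=
      hlim.comp (tendsto_atTop_add_const_right _ _ tendsto_natCast_atTop_atTop)
    simpa using h1.sub (hlim.comp tendsto_natCast_atTop_atTop)
  have hEl : Tendsto (fun n => w (c n) ^ 2 / 2 + F f (v (c n))) atTop (𝓝 (F f l)) := by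
    have h := ((hw0.pow 2).div_const 2).add
      ((hasDerivAt_F hf l).continuousAt.tendsto.comp (hlim.comp hctop))
    simpa using h
  rw [hconst x hx]
  refine tendsto_nhds_unique (tendsto_const_nhds.congr fun n => ?_) hEl
  exact (hconst (c n) ((Nat.cast_nonneg n).trans (hc n).1.le)).symm

/-- A function on the half-line without critical points below its limit at infinity attains no
value below both that limit and its value at the origin. -/
lemma le_of_no_critical_point_below_limit {v w : ℝ → ℝ} {l x : ℝ}
    (hv : ∀ x, 0 ≤ x → HasDerivWithinAt v (w x) (Ici 0) x)
    (hlim : Tendsto v atTop (𝓝 l))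
    (hcrit : ∀ y, 0 ≤ y → w y = 0 → l ≤ v y) (hx : 0 ≤ x) (hxl : v x < l) :
    v 0 ≤ v x := by
  by_contra! hx0
  obtain ⟨M, hM, hxM⟩ := ((hlim.eventually (lt_mem_nhds hxl)).and (eventually_ge_atTop x)).exists
  obtain ⟨y, hy, hmin⟩ := isCompact_Icc.exists_isMinOn (s := Icc 0 M) ⟨x, hx, hxM⟩
    (fun z hz => ((hv z hz.1).continuousWithinAt).mono Icc_subset_Ici_self)
  have hyx : v y ≤ v x := hmin ⟨hx, hxM⟩
  have hy0 : 0 < y := hy.1.lt_of_ne (by rintro rfl; exact hyx.not_gt hx0)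
  have hyM : y < M := hy.2.lt_of_ne (by rintro rfl; exact hyx.not_gt hM)
  have h0 : w y = 0 := (hmin.isLocalMin (Icc_mem_nhds hy0 hyM)).hasDerivAt_eq_zero
    ((hv y hy.1).hasDerivAt (Ici_mem_nhds hy0))
  exact ((hcrit y hy.1 h0).trans hyx).not_gt hxl

/-- Complete invasion on a star graph: a stationary solution with values in
`(0,1]` tending to `1` along every edge is identically `1`. -/
theorem star_graph_complete_invasion (f : ℝ → ℝ) (a : ℝ) (hf : Bistable f a)
    (N : ℕ) (hN : 2 ≤ N) (ρ : Fin N → ℝ) (hρ : ∀ j, 0 < ρ j)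
    (v : Fin N → ℝ → ℝ)
    (hcont : ∀ j, ContinuousOn (v j) (Ici 0))
    (hC2 : ∀ j, ContDiffOn ℝ 2 (v j) (Ici 0))
    (heq : ∀ j, ∀ x : ℝ, 0 ≤ x →
      derivWithin (derivWithin (v j) (Ici 0)) (Ici 0) x + f (v j x) = 0)
    (hbd : ∀ j, ∀ x : ℝ, 0 ≤ x → 0 < v j x ∧ v j x ≤ 1)
    (hjunc : ∀ j k, v j 0 = v k 0)
    (hK : (∑ j, ρ j * derivWithin (v j) (Ici 0) 0) = 0)
    (hlim : ∀ j, Tendsto (v j) atTop (𝓝 1)) :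
    ∀ j, ∀ x : ℝ, 0 ≤ x → v j x = 1 := by
  have hv : ∀ j x, 0 ≤ x → HasDerivWithinAt (v j) (derivWithin (v j) (Ici 0) x) (Ici 0) x :=
    fun j x hx => ((hC2 j).differentiableOn (by norm_num) x hx).hasDerivWithinAt
  have hw : ∀ j x, 0 ≤ x →
      HasDerivWithinAt (derivWithin (v j) (Ici 0)) (-f (v j x)) (Ici 0) x := by
    intro j x hx
    have hd : ContDiffOn ℝ 1 (derivWithin (v j) (Ici 0)) (Ici 0) :=
      (hC2 j).derivWithin (uniqueDiffOn_Ici 0) (by norm_num)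
    exact (hd.differentiableOn (by norm_num) x hx).hasDerivWithinAt.congr_deriv
      (eq_neg_of_add_eq_zero_left (heq j x hx))
  have hE : ∀ j x, 0 ≤ x →
      derivWithin (v j) (Ici 0) x ^ 2 / 2 + F f (v j x) = F f 1 :=
    fun j x hx => energy_eq_of_tendsto hf.continuous (hv j) (hw j) (hlim j) hx
  have hcrit : ∀ j x, 0 ≤ x → derivWithin (v j) (Ici 0) x = 0 → 1 ≤ v j x := by
    intro j x hx h0
    by_contra! hlt
    have h := hE j x hx
    rw [h0] at h
    have := hf.F_lt_F_one (hbd j x hx).1 hlt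
    norm_num at h
    exact this.ne h
  have hmin : ∀ j x, 0 ≤ x → v j x < 1 → v j 0 ≤ v j x := fun j x hx =>
    le_of_no_critical_point_below_limit (hv j) (hlim j) (hcrit j) hx
  have hone : ∀ j, v j 0 = 1 := by
    intro j
    by_contra hne
    have hlt : ∀ k, v k 0 < 1 := fun k =>
      hjunc j k ▸ lt_of_le_of_ne (hbd j 0 le_rfl).2 hne
    have hpos : ∀ k, 0 < derivWithin (v k) (Ici 0) 0 := by
      intro k
      by_contra! hle
      have hneg : derivWithin (v k) (Ici 0) 0 < 0 :=
        hle.lt_of_ne fun h => (hcrit k 0 le_rfl h).not_gt (hlt k)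
      obtain ⟨z, hz, hz0⟩ := ((hv k 0 le_rfl).liminf_right_slope_le hneg).and_eventually
        self_mem_nhdsWithin |>.exists
      have hz0 : 0 < z := hz0
      rw [slope_def_field, sub_zero, div_neg_iff] at hz
      have hzv : v k z < v k 0 := by
        rcases hz with h | h <;> linarith [h.1, h.2]
      exact (hmin k z hz0.le (hzv.trans (hlt k))).not_gt hzv
    exact (Finset.sum_pos (fun k _ => mul_pos (hρ k) (hpos k)) ⟨j, Finset.mem_univ j⟩).ne' hK
  intro j x hx
  refine (hbd j x hx).2.antisymm ?_
  by_contra! hlt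
  exact (hmin j x hx hlt).not_gt (hone j ▸ hlt)
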